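/- In the minimum-counterexample setup, let c be an acyclic edge coloring of G−xy using Δ+1 colors, μ = c(y,y'), and γ ∈ C − F''_x(c). Define c_γ = c if γ ∉ F_x(c), and otherwise let c_γ be obtained from c by uncoloring the edge xw where w is the degree-2 neighbor of x with c(x,w)=γ. Then no (μ,γ,xy)-critical path with respect to c_γ contains a vertex w' ∈ N_G(x)−{y} with deg_G(w')=2. -/

import Mathlib

open SimpleGraph

namespace AEC

variable {V : Type*}

/-- The set of colors appearing (under partial coloring `c`) on colored edges incident
with the vertex `u` (i.e. `F_u`). -/
def colorsAt (G : SimpleGraph V) (c : Sym2 V → Option ℕ) (u : V) : Set ℕ :=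
  {γ | ∃ z, G.Adj u z ∧ c s(u, z) = some γ}

/-- `S_ab`: the set of colors appearing on the colored edges incident with `b`
other than the edge `ab`. -/
def Sset (G : SimpleGraph V) (c : Sym2 V → Option ℕ) (a b : V) : Set ℕ :=
  {γ | ∃ z, G.Adj b z ∧ z ≠ a ∧ c s(b, z) = some γ}

/-- A partial edge coloring (colors are `ℕ`, `none` = uncolored): it may only color
edges of `G`, and colored edges sharing an endpoint receive distinct colors. -/
def ProperPartialColoring (G : SimpleGraph V) (c : Sym2 V → Option ℕ) : Prop :=
  (∀ e, (c e).isSome → e ∈ G.edgeSet) ∧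
  ∀ ⦃u v w : V⦄, G.Adj u v → G.Adj u w → v ≠ w → (c s(u, v)).isSome →
    c s(u, v) ≠ c s(u, w)

/-- A valid (acyclic) partial coloring: proper, and no cycle of `G` is bichromatic,
i.e. no cycle has all of its edges colored using only two colors. -/
def AcyclicPartialColoring (G : SimpleGraph V) (c : Sym2 V → Option ℕ) : Prop :=
  ProperPartialColoring G c ∧
  ∀ (α β : ℕ) (v : V) (W : G.Walk v v), W.IsCycle →
    ¬ ∀ e ∈ W.edges, c e = some α ∨ c e = some β

/-- An acyclic edge coloring of `G` using (at most) `k` colors: a valid partial coloring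
that colors every edge of `G` with a color `< k`. -/
def IsAcyclicEdgeColoring (G : SimpleGraph V) (k : ℕ) (c : Sym2 V → Option ℕ) : Prop :=
  AcyclicPartialColoring G c ∧ ∀ e ∈ G.edgeSet, ∃ a, a < k ∧ c e = some a

/-- `G` is 2-degenerate: every nonempty (induced) subgraph has a vertex of degree at most 2. -/
def TwoDegenerate [DecidableEq V] (G : SimpleGraph V) [DecidableRel G.Adj] : Prop :=
  ∀ s : Finset V, s.Nonempty → ∃ v ∈ s, (s.filter fun u => G.Adj v u).card ≤ 2

/-- A maximal `(α,β)`-bichromatic path from `a` to `b`: a path all of whose edges are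
colored `α` or `β`, which cannot be extended at either end. -/
def IsMaximalBichromaticPath (G : SimpleGraph V) (c : Sym2 V → Option ℕ)
    (α β : ℕ) {a b : V} (W : G.Walk a b) : Prop :=
  W.IsPath ∧ (∀ e ∈ W.edges, c e = some α ∨ c e = some β) ∧
  (∀ w, G.Adj a w → (c s(a, w) = some α ∨ c s(a, w) = some β) → w ∈ W.support) ∧
  (∀ w, G.Adj b w → (c s(b, w) = some α ∨ c s(b, w) = some β) → w ∈ W.support)

/-- An `(α,β,a,b)`-maximal bichromatic path: a maximal `(α,β)`-bichromatic path from
`a` to `b` whose edge incident on `a` is colored `α`. -/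
def IsMaxBichromaticPathFrom (G : SimpleGraph V) (c : Sym2 V → Option ℕ)
    (α β : ℕ) {a b : V} (W : G.Walk a b) : Prop :=
  IsMaximalBichromaticPath G c α β W ∧ ∃ e, W.edges.head? = some e ∧ c e = some α

/-- An `(α,β,ab)`-critical path: a maximal `(α,β)`-bichromatic path from `a` to `b` whose
edges incident on `a` and on `b` are both colored `α`. -/
def IsCriticalPath (G : SimpleGraph V) (c : Sym2 V → Option ℕ)
    (α β : ℕ) {a b : V} (W : G.Walk a b) : Prop :=
  IsMaxBichromaticPathFrom G c α β W ∧ ∃ e, W.edges.getLast? = some e ∧ c e = some α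

/-- `F''_x(c)`: colors of edges from `x` to its neighbors (other than `y`) of degree ≥ 3. -/
def Fpp [Fintype V] (G : SimpleGraph V) [DecidableRel G.Adj]
    (c : Sym2 V → Option ℕ) (x y : V) : Set ℕ :=
  {γ | ∃ z, G.Adj x z ∧ z ≠ y ∧ 3 ≤ G.degree z ∧ c s(x, z) = some γ}

/-- `F'_x(c)`: colors of edges from `x` to its neighbors (other than `y`) of degree 2. -/
def Fp [Fintype V] (G : SimpleGraph V) [DecidableRel G.Adj]
    (c : Sym2 V → Option ℕ) (x y : V) : Set ℕ :=
  {γ | ∃ z, G.Adj x z ∧ z ≠ y ∧ G.degree z = 2 ∧ c s(x, z) = some γ}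

/-- `F_x(c) = F'_x(c) ∪ F''_x(c)`. -/
def Fx [Fintype V] (G : SimpleGraph V) [DecidableRel G.Adj]
    (c : Sym2 V → Option ℕ) (x y : V) : Set ℕ :=
  Fp G c x y ∪ Fpp G c x y

theorem exists_ne_mem_edges_of_isCycle {G : SimpleGraph V} {u v : V} {W : G.Walk u u}
    (hW : W.IsCycle) (hv : v ∈ W.support) (a : V) : ∃ b, b ≠ a ∧ s(v, b) ∈ W.edges := by
  obtain ⟨b, hb, hba⟩ := Set.exists_ne_of_one_lt_ncard
    (by rw [hW.ncard_neighborSet_toSubgraph_eq_two hv]; norm_num :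
      1 < (W.toSubgraph.neighborSet v).ncard) a
  exact ⟨b, hba, W.mem_edges_toSubgraph.1 hb⟩

theorem eq_of_adj_of_degree_eq_two [Fintype V] {G : SimpleGraph V} [DecidableRel G.Adj]
    {v a b d : V} (hv : G.degree v = 2) (ha : G.Adj v a) (hb : G.Adj v b) (hd : G.Adj v d)
    (hba : b ≠ a) (hda : d ≠ a) : b = d := by
  classical
  by_contra hbd
  have hsub : ({a, b, d} : Finset V) ⊆ G.neighborFinset v := by
    simp [Finset.insert_subset_iff, ha, hb, hd]
  have hcard := Finset.card_le_card hsub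
  rw [Finset.card_eq_three.2 ⟨a, b, d, hba.symm, hda.symm, hbd, rfl⟩,
    G.card_neighborFinset_eq_degree, hv] at hcard
  omega

theorem ProperPartialColoring.eq_of_color_eq {G : SimpleGraph V} {c : Sym2 V → Option ℕ}
    (hc : ProperPartialColoring G c) {u v w : V} {α : ℕ} (huv : c s(u, v) = some α)
    (huw : c s(u, w) = some α) : v = w := by
  by_contra hvw
  exact hc.2 (hc.1 s(u, v) (by simp [huv])) (hc.1 s(u, w) (by simp [huw])) hvw (by simp [huv])
    (huv.trans huw.symm)

/-- If one edge at `x` is uncolored, then among `Δ + 1` colors some color other than a given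
one is missing at `x`. -/
theorem exists_missing_color_ne [Fintype V] [DecidableEq V] {G : SimpleGraph V}
    [DecidableRel G.Adj] {x y : V} (hxy : G.Adj x y) {c : Sym2 V → Option ℕ}
    (hc : ProperPartialColoring (G.deleteEdges {s(x, y)}) c) {γ : ℕ}
    (hγ : γ < G.maxDegree + 1) :
    ∃ δ < G.maxDegree + 1, δ ≠ γ ∧ ∀ z, c s(x, z) ≠ some δ := by
  have hlt : (((G.neighborFinset x).erase y).image fun z => (c s(x, z)).getD 0).card <
      ((Finset.range (G.maxDegree + 1)).erase γ).card := by
    refine Finset.card_image_le.trans_lt ?_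
    have hy : y ∈ G.neighborFinset x := by simpa using hxy
    have hpos := Finset.card_pos.2 ⟨y, hy⟩
    rw [Finset.card_erase_of_mem hy, Finset.card_erase_of_mem (Finset.mem_range.2 hγ),
      Finset.card_range]
    rw [G.card_neighborFinset_eq_degree] at hpos ⊢
    have := G.degree_le_maxDegree x
    omega
  obtain ⟨δ, hδ, hδ'⟩ := Finset.exists_mem_notMem_of_card_lt_card hlt
  rw [Finset.mem_erase, Finset.mem_range] at hδ
  refine ⟨δ, hδ.2, hδ.1, fun z hz => hδ' ?_⟩
  have hadj : (G.deleteEdges {s(x, y)}).Adj x z := hc.1 s(x, z) (by simp [hz])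
  rw [deleteEdges_adj] at hadj
  refine Finset.mem_image.2 ⟨z, Finset.mem_erase.2 ⟨?_, by simpa using hadj.1⟩, by simp [hz]⟩
  rintro rfl
  exact hadj.2 rfl

/-- Coloring the missing edge `xy` with a color absent at both ends keeps the coloring proper. -/
theorem ProperPartialColoring.update [DecidableEq V] {G : SimpleGraph V} {x y : V}
    (hxy : G.Adj x y) {c : Sym2 V → Option ℕ}
    (hc : ProperPartialColoring (G.deleteEdges {s(x, y)}) c) {δ : ℕ}
    (hx : ∀ z, c s(x, z) ≠ some δ) (hy : ∀ z, c s(y, z) ≠ some δ) :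
    ProperPartialColoring G (Function.update c s(x, y) (some δ)) := by
  refine ⟨fun e he => ?_, fun u v w huv huw hvw hsome heq => ?_⟩
  · by_cases h : e = s(x, y)
    · exact h ▸ hxy
    · rw [Function.update_of_ne h] at he
      exact edgeSet_mono (deleteEdges_le _) (hc.1 e he)
  · have hmissing : ∀ {a b}, s(u, a) = s(x, y) → c s(u, b) ≠ some δ := by
      intro a b h
      rcases Sym2.eq_iff.1 h with ⟨rfl, -⟩ | ⟨rfl, -⟩
      exacts [hx b, hy b]
    by_cases h₁ : s(u, v) = s(x, y) <;> by_cases h₂ : s(u, w) = s(x, y)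
    · exact hvw (Sym2.congr_right.1 (h₁.trans h₂.symm))
    · rw [h₁, Function.update_self, Function.update_of_ne h₂] at heq
      exact hmissing h₁ heq.symm
    · rw [h₂, Function.update_self, Function.update_of_ne h₁] at heq
      exact hmissing h₂ heq
    · rw [Function.update_of_ne h₁] at heq hsome
      rw [Function.update_of_ne h₂] at heq
      obtain ⟨α, hα⟩ := Option.isSome_iff_exists.1 hsome
      exact hvw (hc.eq_of_color_eq hα (heq ▸ hα))

/-- If `G` has no acyclic edge coloring with `k` colors, then coloring the missing edge `xy` with
a color absent at both ends creates a bichromatic cycle through `xy`. -/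
theorem exists_bichromatic_cycle_of_update [DecidableEq V] {G : SimpleGraph V} {k : ℕ}
    (hG : ¬ ∃ c, IsAcyclicEdgeColoring G k c) {x y : V} (hxy : G.Adj x y)
    {c : Sym2 V → Option ℕ} (hc : IsAcyclicEdgeColoring (G.deleteEdges {s(x, y)}) k c) {δ : ℕ}
    (hδ : δ < k) (hx : ∀ z, c s(x, z) ≠ some δ) (hy : ∀ z, c s(y, z) ≠ some δ) :
    ∃ (α β : ℕ) (v : V) (W : G.Walk v v), W.IsCycle ∧ s(x, y) ∈ W.edges ∧
      ∀ e ∈ W.edges, Function.update c s(x, y) (some δ) e = some α ∨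
        Function.update c s(x, y) (some δ) e = some β := by
  by_contra! hno
  refine hG ⟨Function.update c s(x, y) (some δ),
    ⟨hc.1.1.update hxy hx hy, fun α β v W hW hcol => ?_⟩, fun e he => ?_⟩
  · by_cases hmem : s(x, y) ∈ W.edges
    · obtain ⟨e, he, h₁, h₂⟩ := hno α β v W hW hmem
      exact (hcol e he).elim h₁ h₂
    · have hne : ∀ e ∈ W.edges, e ≠ s(x, y) := fun e he h => hmem (h ▸ he)
      have htr : ∀ e ∈ W.edges, e ∈ (G.deleteEdges {s(x, y)}).edgeSet := fun e he => by
        rw [edgeSet_deleteEdges]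
        exact ⟨W.edges_subset_edgeSet he, hne e he⟩
      refine hc.1.2 α β v (W.transfer _ htr) (hW.transfer htr) fun e he => ?_
      rw [Walk.edges_transfer] at he
      simpa [Function.update_of_ne (hne e he)] using hcol e he
  · by_cases h : e = s(x, y)
    · exact ⟨δ, hδ, by rw [h, Function.update_self]⟩
    · rw [Function.update_of_ne h]
      exact hc.2 e (by rw [edgeSet_deleteEdges]; exact ⟨he, h⟩)

/-- In a graph without an acyclic edge coloring using `Δ + 1` colors, a degree-2 neighbor `v` of
`x` whose edge to `x` has the color of `yy'` has no further colored edge. -/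
theorem not_color_of_degree_two_neighbor [Fintype V] [DecidableEq V] {G : SimpleGraph V}
    [DecidableRel G.Adj]
    (hG : ¬ ∃ c, IsAcyclicEdgeColoring G (G.maxDegree + 1) c) {x y y' v z : V}
    (hxy : G.Adj x y) (hy : G.degree y = 2) (hyy' : G.Adj y y') (hy'x : y' ≠ x)
    {c : Sym2 V → Option ℕ}
    (hc : IsAcyclicEdgeColoring (G.deleteEdges {s(x, y)}) (G.maxDegree + 1) c) {μ γ : ℕ}
    (hμ : c s(y, y') = some μ) (hv : G.degree v = 2) (hvx : c s(x, v) = some μ) (hzx : z ≠ x) :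
    c s(v, z) ≠ some γ := by
  intro hvz
  have hdel {a b : V} {α : ℕ} (h : c s(a, b) = some α) :
      G.Adj a b ∧ s(a, b) ≠ s(x, y) := by
    have := hc.1.1.1 s(a, b) (by simp [h])
    rw [mem_edgeSet, deleteEdges_adj] at this
    exact this
  have hγ : γ < G.maxDegree + 1 := by
    obtain ⟨a, ha, hca⟩ := hc.2 s(v, z) (hc.1.1.1 s(v, z) (by simp [hvz]))
    rw [hvz, Option.some_inj] at hca
    exact hca ▸ ha
  have hγμ : γ ≠ μ := by
    rintro rfl
    exact hzx (hc.1.1.eq_of_color_eq hvz (Sym2.eq_swap ▸ hvx))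
  obtain ⟨δ, hδ, hδγ, hδx⟩ := exists_missing_color_ne hxy hc.1.1 hγ
  have hδμ : δ ≠ μ := by
    rintro rfl
    exact hδx v hvx
  have hδy : ∀ u, c s(y, u) ≠ some δ := by
    intro u hu
    have hux : u ≠ x := by
      rintro rfl
      exact (hdel hu).2 Sym2.eq_swap
    obtain rfl := eq_of_adj_of_degree_eq_two hy hxy.symm (hdel hu).1 hyy' hux hy'x
    exact hδμ (Option.some_inj.1 (hu.symm.trans hμ))
  obtain ⟨α, β, r, W, hW, hxyW, hcol⟩ :=
    exists_bichromatic_cycle_of_update hG hxy hc hδ hδx hδy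
  have hcol' {e : Sym2 V} (he : e ∈ W.edges) (hne : e ≠ s(x, y)) :
      c e = some α ∨ c e = some β := by
    simpa [Function.update_of_ne hne] using hcol e he
  have hδαβ := hcol _ hxyW
  rw [Function.update_self, Option.some_inj, Option.some_inj] at hδαβ
  have hμαβ : μ = α ∨ μ = β := by
    obtain ⟨u, hux, hu⟩ :=
      exists_ne_mem_edges_of_isCycle hW (W.snd_mem_support_of_mem_edges hxyW) x
    obtain rfl := eq_of_adj_of_degree_eq_two hy hxy.symm (W.adj_of_mem_edges hu) hyy' hux hy'x
    simpa [hμ] using hcol' hu (hdel hμ).2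
  have hvW : v ∈ W.support := by
    obtain ⟨u, huy, hu⟩ :=
      exists_ne_mem_edges_of_isCycle hW (W.fst_mem_support_of_mem_edges hxyW) y
    have hcu : c s(x, u) = some μ := by
      have h := hcol' hu fun h => huy (Sym2.congr_right.1 h)
      have h' := hδx u
      grind
    obtain rfl := hc.1.1.eq_of_color_eq hcu hvx
    exact W.snd_mem_support_of_mem_edges hu
  obtain ⟨u, hux, hu⟩ := exists_ne_mem_edges_of_isCycle hW hvW x
  obtain rfl := eq_of_adj_of_degree_eq_two hv (hdel hvx).1.symm (W.adj_of_mem_edges hu)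
    (hdel hvz).1 hux hzx
  have h := hcol' hu (hdel hvz).2
  grind

/-- An interior degree-2 vertex of a path has both of its edges on the path. -/
theorem exists_edges_of_degree_two_mem_support [Fintype V] {G : SimpleGraph V}
    [DecidableRel G.Adj] {x y v : V} (hxy : G.Adj x y)
    (W : (G.deleteEdges {s(x, y)}).Walk x y) (hW : W.IsPath) (hv : G.degree v = 2)
    (hxv : G.Adj x v) (hvy : v ≠ y) (hvW : v ∈ W.support) :
    s(x, v) ∈ W.edges ∧ ∃ z, z ≠ x ∧ s(v, z) ∈ W.edges := by
  have hle := G.deleteEdges_le {s(x, y)}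
  have hcycle : (Walk.cons hxy.symm (W.mapLe hle)).IsCycle := by
    rw [Walk.cons_isCycle_iff]
    refine ⟨hW.mapLe hle, fun h => ?_⟩
    rw [Walk.edges_mapLe_eq_edges] at h
    have := W.edges_subset_edgeSet h
    rw [edgeSet_deleteEdges] at this
    exact this.2 Sym2.eq_swap
  have hmem : v ∈ (Walk.cons hxy.symm (W.mapLe hle)).support := by simp [hvW]
  have hedge {a : V} (h : s(v, a) ∈ (Walk.cons hxy.symm (W.mapLe hle)).edges) :
      s(v, a) ∈ W.edges := by
    rw [Walk.edges_cons, List.mem_cons, Walk.edges_mapLe_eq_edges] at h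
    refine h.resolve_left fun h => ?_
    rcases Sym2.eq_iff.1 h with ⟨h, -⟩ | ⟨h, -⟩
    exacts [hvy h, hxv.ne' h]
  obtain ⟨z, hzx, hz⟩ := exists_ne_mem_edges_of_isCycle hcycle hmem x
  obtain ⟨u, huz, hu⟩ := exists_ne_mem_edges_of_isCycle hcycle hmem z
  obtain rfl := eq_of_adj_of_degree_eq_two hv (Walk.adj_of_mem_edges _ hz)
    (Walk.adj_of_mem_edges _ hu) hxv.symm huz hzx.symm
  exact ⟨(Sym2.eq_swap : s(v, u) = s(u, v)) ▸ hedge hu, z, hzx, hedge hz⟩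

/-- Lemma 9: in the minimum-counterexample setup, for `μ = c(y,y')` and
`γ ∈ C − F''_x(c)`, no `(μ,γ,xy)`-critical path with respect to `c_γ` contains a vertex
`w' ∈ N_G(x) − {y}` of degree 2. -/
theorem criticalPath_avoids_degree_two_neighbors
    {V : Type*} [Fintype V] [DecidableEq V] (G : SimpleGraph V) [DecidableRel G.Adj]
    (h2deg : TwoDegenerate G)
    (hmin : ¬ ∃ c : Sym2 V → Option ℕ, IsAcyclicEdgeColoring G (G.maxDegree + 1) c)
    (hdel : ∀ e ∈ G.edgeSet, ∃ c : Sym2 V → Option ℕ,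
      IsAcyclicEdgeColoring (G.deleteEdges {e}) (G.maxDegree + 1) c)
    (x : V)
    (hxdeg2 : ∃ z, G.Adj x z ∧ G.degree z = 2)
    (hxdeg3 : ((G.neighborFinset x).filter fun z => 3 ≤ G.degree z).card ≤ 2)
    (y y' : V) (hxy : G.Adj x y) (hy2 : G.degree y = 2)
    (hyy' : G.Adj y y') (hy'x : y' ≠ x)
    (c : Sym2 V → Option ℕ)
    (hc : IsAcyclicEdgeColoring (G.deleteEdges {s(x, y)}) (G.maxDegree + 1) c)
    (μ γ : ℕ) (hμ : c s(y, y') = some μ)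
    (hγC : γ < G.maxDegree + 1) (hγF : γ ∉ Fpp G c x y)
    (cγ : Sym2 V → Option ℕ)
    (hcγ : (γ ∉ Fx G c x y ∧ cγ = c) ∨
      (∃ w, G.Adj x w ∧ w ≠ y ∧ G.degree w = 2 ∧ c s(x, w) = some γ ∧
        cγ = fun e => if e = s(x, w) then none else c e)) :
    ∀ W : (G.deleteEdges {s(x, y)}).Walk x y,
      IsCriticalPath (G.deleteEdges {s(x, y)}) cγ μ γ W →
      ∀ w', G.Adj x w' → w' ≠ y → G.degree w' = 2 → w' ∉ W.support := by
  intro W hW w' hxw' hw'y hw' hmem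
  have hsub {e : Sym2 V} {α : ℕ} (h : cγ e = some α) : c e = some α := by
    rcases hcγ with ⟨-, rfl⟩ | ⟨w, -, -, -, -, rfl⟩
    · exact h
    · grind
  obtain ⟨⟨⟨hpath, hcol, -⟩, -⟩, -⟩ := hW
  obtain ⟨hxw, z, hzx, hz⟩ := exists_edges_of_degree_two_mem_support hxy W hpath hw' hxw' hw'y hmem
  have hμw : c s(x, w') = some μ := by
    refine (hcol _ hxw).elim hsub fun h => ?_
    exfalso
    rcases hcγ with ⟨hγ, -⟩ | ⟨w, -, -, -, hw, hdef⟩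
    · exact hγ (Or.inl ⟨w', hxw', hw'y, hw', hsub h⟩)
    · obtain rfl := hc.1.1.eq_of_color_eq hw (hsub h)
      simp [hdef] at h
  rcases hcol _ hz with h | h <;>
    exact not_color_of_degree_two_neighbor hmin hxy hy2 hyy' hy'x hc hμ hw' hμw hzx (hsub h)

end AEC
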